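/- arXiv:2211.07942 — 5 statements merged into one kernel-verified Lean document; each statement's English description precedes it below -/
import Mathlib

section
/- Let γ = exp(−2πi/3), let V ∈ ℂ³ satisfy V_2 = γ·V_1 and V_3 = γ²·V_1 (exactly balanced voltage), and let Λ be the 3×3 matrix with rows (1,−1,0), (0,1,−1), (−1,0,1). For any I ∈ ℂ³ define S^d_φ = (ΛV)_φ · conj(I_φ) and S^b_φ = V_φ · conj((Λᵀ I)_φ). Then S^d_2 = (1−γ)·γ·[ γ^{-1}·S^b_2 + (1−γ)^{-1}·S^d_1 ], i.e., S^d_2 = (1−γ)·S^b_2 + γ·S^d_1. -/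
open Matrix Complex

/-- γ = exp(−2πi/3). -/
noncomputable def gammaRot : ℂ := Complex.exp (-(2 * Real.pi * Complex.I) / 3)

/-- The matrix Λ with rows (1,−1,0), (0,1,−1), (−1,0,1). -/
def deltaLambda : Matrix (Fin 3) (Fin 3) ℂ := !![1, -1, 0; 0, 1, -1; -1, 0, 1]

theorem gammaRot_ne_zero : gammaRot ≠ 0 := Complex.exp_ne_zero _

theorem gammaRot_ne_one : gammaRot ≠ 1 := by
  intro h
  obtain ⟨n, hn⟩ := Complex.exp_eq_one_iff.mp h
  have h3 : (3 * n + 1 : ℂ) = 0 := by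
    refine (mul_eq_zero.mp ?_).resolve_right Complex.two_pi_I_ne_zero
    linear_combination -3 * hn
  have hz : 3 * n + 1 = 0 := by exact_mod_cast h3
  omega

/-- For an exactly balanced voltage `V` and any delta current `Iv`, with
`Sd φ = (Λ V) φ · conj(Iv φ)` and `Sb φ = V φ · conj((Λᵀ Iv) φ)`, the second-leg
device power satisfies
`Sd 1 = (1−γ)·γ·(γ⁻¹·Sb 1 + (1−γ)⁻¹·Sd 0)`, i.e. `Sd 1 = (1−γ)·Sb 1 + γ·Sd 0`. -/
theorem delta_leg2_power (V Iv : Fin 3 → ℂ)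
    (hV2 : V 1 = gammaRot * V 0) (hV3 : V 2 = gammaRot ^ 2 * V 0)
    (Sd Sb : Fin 3 → ℂ)
    (hSd : ∀ φ, Sd φ = (deltaLambda.mulVec V) φ * (starRingEnd ℂ) (Iv φ))
    (hSb : ∀ φ, Sb φ = V φ * (starRingEnd ℂ) ((deltaLambda.transpose.mulVec Iv) φ)) :
    Sd 1 = (1 - gammaRot) * gammaRot *
        (gammaRot⁻¹ * Sb 1 + (1 - gammaRot)⁻¹ * Sd 0) ∧
      Sd 1 = (1 - gammaRot) * Sb 1 + gammaRot * Sd 0 := by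
  have h1 : 1 - gammaRot ≠ 0 := sub_ne_zero.mpr gammaRot_ne_one.symm
  have key : Sd 1 = (1 - gammaRot) * Sb 1 + gammaRot * Sd 0 := by
    rw [hSd, hSd, hSb]
    simp [deltaLambda, Matrix.mulVec, dotProduct, Fin.sum_univ_three, hV2, hV3]
    ring
  refine ⟨?_, key⟩
  rw [key]
  field_simp [gammaRot_ne_zero]
end

section
/- Let γ = exp(−2πi/3), let V ∈ ℂ³ satisfy V_2 = γ·V_1 and V_3 = γ²·V_1 (exactly balanced voltage), and let Λ be the 3×3 matrix with rows (1,−1,0), (0,1,−1), (−1,0,1). For any I ∈ ℂ³ define S^d_φ = (ΛV)_φ · conj(I_φ) and S^b_φ = V_φ · conj((Λᵀ I)_φ). Then S^d_3 = (γ² − 1)·[ γ^{-1}·S^b_2 + γ^{-2}·S^b_3 + (1−γ)^{-1}·S^d_1 ]. -/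
open Matrix Complex

/-- For an exactly balanced voltage `V` and any delta current `Iv`, with
`Sd φ = (Λ V) φ · conj(Iv φ)` and `Sb φ = V φ · conj((Λᵀ Iv) φ)`, the third-leg
device power satisfies
`Sd 2 = (γ² − 1)·(γ⁻¹·Sb 1 + (γ²)⁻¹·Sb 2 + (1−γ)⁻¹·Sd 0)`. -/
theorem delta_leg3_power (V Iv : Fin 3 → ℂ)
    (hV2 : V 1 = gammaRot * V 0) (hV3 : V 2 = gammaRot ^ 2 * V 0)
    (Sd Sb : Fin 3 → ℂ)
    (hSd : ∀ φ, Sd φ = (deltaLambda.mulVec V) φ * (starRingEnd ℂ) (Iv φ))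
    (hSb : ∀ φ, Sb φ = V φ * (starRingEnd ℂ) ((deltaLambda.transpose.mulVec Iv) φ)) :
    Sd 2 = (gammaRot ^ 2 - 1) *
        (gammaRot⁻¹ * Sb 1 + (gammaRot ^ 2)⁻¹ * Sb 2 + (1 - gammaRot)⁻¹ * Sd 0) := by
  have h0 := gammaRot_ne_zero
  have h1 : 1 - gammaRot ≠ 0 := sub_ne_zero.mpr gammaRot_ne_one.symm
  simp only [hSd, hSb]
  simp [deltaLambda, Matrix.mulVec, dotProduct, Fin.sum_univ_three, hV2, hV3]
  field_simp
  ring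
end

section
/- Let γ = exp(−2πi/3), let V ∈ ℂ³ satisfy V_2 = γ·V_1 and V_3 = γ²·V_1 (exactly balanced voltage), and let Λ be the 3×3 matrix with rows (1,−1,0), (0,1,−1), (−1,0,1). For any I ∈ ℂ³, write S^b_φ = p^b_φ + i·q^b_φ = V_φ·conj((ΛᵀI)_φ) and S^d_φ = p^d_φ + i·q^d_φ = (ΛV)_φ·conj(I_φ) with p^b_φ, q^b_φ, p^d_φ, q^d_φ ∈ ℝ. Then the following six real linear equations hold exactly: (i) p^b_1+p^b_2+p^b_3 = p^d_1+p^d_2+p^d_3; (ii) q^b_1+q^b_2+q^b_3 = q^d_1+q^d_2+q^d_3; (iii) (3/2)p^b_2 − (√3/2)q^b_2 = p^d_2 + (1/2)p^d_1 − (√3/2)q^d_1; (iv) (√3/2)p^b_2 + (3/2)q^b_2 = (√3/2)p^d_1 + (1/2)q^d_1 + q^d_2; (v) √3·q^b_2 + (3/2)p^b_3 − (√3/2)q^b_3 = (1/2)p^d_1 + (√3/2)q^d_1 + p^d_3; (vi) −√3·p^b_2 + (√3/2)p^b_3 + (3/2)q^b_3 = −(√3/2)p^d_1 + (1/2)q^d_1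 + q^d_3. -/
open Matrix Complex

theorem gammaRot_eq : gammaRot = -(1 / 2) - (Real.sqrt 3 / 2 : ℝ) * Complex.I := by
  have harg : (-(2 * Real.pi * Complex.I) / 3 : ℂ) =
      ((Real.pi / 3 - Real.pi : ℝ) : ℂ) * Complex.I := by
    push_cast
    ring
  rw [gammaRot, harg, Complex.exp_mul_I, ← Complex.ofReal_cos, ← Complex.ofReal_sin,
    Real.cos_sub_pi, Real.sin_sub_pi, Real.cos_pi_div_three, Real.sin_pi_div_three]
  push_cast
  ring

theorem gammaRot_pow_three : gammaRot ^ 3 = 1 := by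
  rw [gammaRot, ← Complex.exp_nat_mul, Complex.exp_eq_one_iff]
  exact ⟨-1, by push_cast; ring⟩

theorem gammaRot_sq : gammaRot ^ 2 = -(1 / 2) + (Real.sqrt 3 / 2 : ℝ) * Complex.I := by
  have hs : ((Real.sqrt 3 : ℝ) : ℂ) ^ 2 = 3 := by
    rw [← Complex.ofReal_pow, Real.sq_sqrt (by norm_num)]
    norm_num
  rw [gammaRot_eq]
  push_cast
  linear_combination ((Real.sqrt 3 : ℂ) ^ 2 / 4) * Complex.I_sq - hs / 4

/-- For an exactly balanced voltage `V` and any delta current `Iv`, writing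
`Sb φ = pb φ + i·qb φ = V φ · conj((Λᵀ Iv) φ)` and
`Sd φ = pd φ + i·qd φ = (Λ V) φ · conj(Iv φ)`, the six real linear coupling
equations of the linearized OPF model hold exactly. -/
theorem delta_coupling_equations (V Iv : Fin 3 → ℂ)
    (hV2 : V 1 = gammaRot * V 0) (hV3 : V 2 = gammaRot ^ 2 * V 0)
    (pb qb pd qd : Fin 3 → ℝ)
    (hSb : ∀ φ, (pb φ : ℂ) + Complex.I * (qb φ) =
      V φ * (starRingEnd ℂ) ((deltaLambda.transpose.mulVec Iv) φ))
    (hSd : ∀ φ, (pd φ : ℂ) + Complex.I * (qd φ) =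
      (deltaLambda.mulVec V) φ * (starRingEnd ℂ) (Iv φ)) :
    pb 0 + pb 1 + pb 2 = pd 0 + pd 1 + pd 2 ∧
    qb 0 + qb 1 + qb 2 = qd 0 + qd 1 + qd 2 ∧
    (3 / 2) * pb 1 - (Real.sqrt 3 / 2) * qb 1
      = pd 1 + (1 / 2) * pd 0 - (Real.sqrt 3 / 2) * qd 0 ∧
    (Real.sqrt 3 / 2) * pb 1 + (3 / 2) * qb 1
      = (Real.sqrt 3 / 2) * pd 0 + (1 / 2) * qd 0 + qd 1 ∧
    Real.sqrt 3 * qb 1 + (3 / 2) * pb 2 - (Real.sqrt 3 / 2) * qb 2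
      = (1 / 2) * pd 0 + (Real.sqrt 3 / 2) * qd 0 + pd 2 ∧
    -(Real.sqrt 3) * pb 1 + (Real.sqrt 3 / 2) * pb 2 + (3 / 2) * qb 2
      = -(Real.sqrt 3 / 2) * pd 0 + (1 / 2) * qd 0 + qd 2 := by
  have b0 := hSb 0
  have b1 := hSb 1
  have b2 := hSb 2
  have d0 := hSd 0
  have d1 := hSd 1
  have d2 := hSd 2
  simp only [deltaLambda, Matrix.mulVec, dotProduct, Fin.sum_univ_three, Matrix.transpose_apply,
    Matrix.of_apply, Matrix.cons_val, hV2, hV3, map_add, map_mul, map_neg, map_one,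
    map_zero] at b0 b1 b2 d0 d1 d2
  have hγ := gammaRot_pow_three
  have total : (pb 0 + Complex.I * qb 0 + (pb 1 + Complex.I * qb 1) + (pb 2 + Complex.I * qb 2) : ℂ)
      = pd 0 + Complex.I * qd 0 + (pd 1 + Complex.I * qd 1) + (pd 2 + Complex.I * qd 2) := by
    rw [b0, b1, b2, d0, d1, d2]
    ring
  have second : (1 - gammaRot) * (pb 1 + Complex.I * qb 1)
      = pd 1 + Complex.I * qd 1 - gammaRot * (pd 0 + Complex.I * qd 0) := by
    rw [b1, d0, d1]
    ring
  have third : (gammaRot - gammaRot ^ 2) * (pb 1 + Complex.I * qb 1)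
        + (1 - gammaRot) * (pb 2 + Complex.I * qb 2)
      = pd 2 + Complex.I * qd 2 - gammaRot ^ 2 * (pd 0 + Complex.I * qd 0) := by
    rw [b1, b2, d0, d2]
    linear_combination (-V 0 * (starRingEnd ℂ) (Iv 2)) * hγ
  rw [gammaRot_eq] at second
  rw [gammaRot_sq, gammaRot_eq] at third
  have totalRe := congrArg Complex.re total
  have totalIm := congrArg Complex.im total
  have secondRe := congrArg Complex.re second
  have secondIm := congrArg Complex.im second
  have thirdRe := congrArg Complex.re third
  have thirdIm := congrArg Complex.im third
  simp [-Complex.ofReal_div] at totalRe totalIm secondRe secondIm thirdRe thirdIm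
  refine ⟨?_, ?_, ?_, ?_, ?_, ?_⟩
  · linear_combination totalRe
  · linear_combination totalIm
  · linear_combination secondRe
  · linear_combination secondIm
  · linear_combination thirdRe
  · linear_combination thirdIm
end

section
/- Consider the 6×6 real matrix A acting on the unknown vector x = (p^b_1, q^b_1, p^b_2, q^b_2, p^b_3, q^b_3) whose six rows correspond to the left-hand sides: (i) p^b_1+p^b_2+p^b_3; (ii) q^b_1+q^b_2+q^b_3; (iii) (3/2)p^b_2 − (√3/2)q^b_2; (iv) (√3/2)p^b_2 + (3/2)q^b_2; (v) √3·q^b_2 + (3/2)p^b_3 − (√3/2)q^b_3; (vi) −√3·p^b_2 + (√3/2)p^b_3 + (3/2)q^b_3. Then A is invertible; consequently, for every right-hand-side vector b ∈ ℝ⁶ there exists a unique x ∈ ℝ⁶ with A·x = b, i.e., the bus-side powers (p^b, q^b) are uniquely determined by the delta-side powers (p^d, q^d) through the six linear coupling equations. -/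
open Matrix

/-- The 6×6 coefficient matrix `A` of the six linear coupling equations, acting on the
unknown vector `x = (pb 1, qb 1, pb 2, qb 2, pb 3, qb 3)`. -/
noncomputable def couplingA : Matrix (Fin 6) (Fin 6) ℝ :=
  !![1, 0, 1, 0, 1, 0;
     0, 1, 0, 1, 0, 1;
     0, 0, 3 / 2, -(Real.sqrt 3 / 2), 0, 0;
     0, 0, Real.sqrt 3 / 2, 3 / 2, 0, 0;
     0, 0, 0, Real.sqrt 3, 3 / 2, -(Real.sqrt 3 / 2);
     0, 0, -(Real.sqrt 3), 0, Real.sqrt 3 / 2, 3 / 2]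

/-- The determinant of the coefficient matrix of the coupling equations is `9`. -/
theorem det_couplingA : couplingA.det = 9 := by
  have h : Real.sqrt 3 ^ 2 = 3 := Real.sq_sqrt (by norm_num)
  simp [couplingA, Matrix.det_succ_row_zero, Fin.sum_univ_succ, Fin.succAbove]
  linear_combination (Real.sqrt 3 ^ 2 / 16 + 21 / 16) * h

/-- The coefficient matrix `A` of the six coupling equations is invertible; consequently,
for every right-hand side `b ∈ ℝ⁶` there is a unique `x ∈ ℝ⁶` with `A · x = b`, i.e. the
bus-side powers are uniquely determined by the delta-side powers. -/
theorem couplingA_invertible :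
    IsUnit couplingA ∧ ∀ b : Fin 6 → ℝ, ∃! x : Fin 6 → ℝ, couplingA.mulVec x = b := by
  have h_unit : IsUnit couplingA := by
    rw [Matrix.isUnit_iff_isUnit_det, det_couplingA]
    norm_num
  exact ⟨h_unit, Function.bijective_iff_existsUnique _ |>.mp
    ⟨Matrix.mulVec_injective_iff_isUnit.mpr h_unit,
      Matrix.mulVec_surjective_iff_isUnit.mpr h_unit⟩⟩
end

section
/- Let γ = exp(−2πi/3) and let Γ be the 3×3 complex matrix with rows (1, γ², γ), (γ, 1, γ²), (γ², γ, 1). Suppose V ∈ ℂ³ is exactly balanced (V_2 = γV_1, V_3 = γ²V_1) with V_1 ≠ 0. Then for every I ∈ ℂ³, the matrix M = V·I^H ∈ ℂ^{3×3} (i.e., M_{φψ} = V_φ·conj(I_ψ)) satisfies M_{φψ} = Γ_{φψ}·S_ψ for all φ, ψ, where S_ψ = V_ψ·conj(I_ψ); equivalently M = Γ·diag(S) where diag(S) is the diagonal matrix with diagonal entries S_1, S_2, S_3. -/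
open Matrix Complex

/-- The matrix Γ with rows (1, γ², γ), (γ, 1, γ²), (γ², γ, 1). -/
noncomputable def gammaMat : Matrix (Fin 3) (Fin 3) ℂ :=
  !![1, gammaRot ^ 2, gammaRot;
     gammaRot, 1, gammaRot ^ 2;
     gammaRot ^ 2, gammaRot, 1]

/-- For an exactly balanced voltage `V` with `V 0 ≠ 0` and any current `Iv ∈ ℂ³`, the
matrix `M = V·Ivᴴ` (entries `M φ ψ = V φ · conj(Iv ψ)`) satisfies
`M φ ψ = Γ φ ψ · S ψ` where `S ψ = V ψ · conj(Iv ψ)`; equivalently `M = Γ · diag(S)`. -/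
theorem balanced_M_eq_Gamma_diag_S (V Iv : Fin 3 → ℂ)
    (hV2 : V 1 = gammaRot * V 0) (hV3 : V 2 = gammaRot ^ 2 * V 0) (hV0 : V 0 ≠ 0)
    (M : Matrix (Fin 3) (Fin 3) ℂ)
    (hM : ∀ φ ψ, M φ ψ = V φ * (starRingEnd ℂ) (Iv ψ))
    (S : Fin 3 → ℂ) (hS : ∀ ψ, S ψ = V ψ * (starRingEnd ℂ) (Iv ψ)) :
    (∀ φ ψ, M φ ψ = gammaMat φ ψ * S ψ) ∧ M = gammaMat * Matrix.diagonal S := by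
  have h3 := gammaRot_pow_three
  have hentry : ∀ φ ψ, M φ ψ = gammaMat φ ψ * S ψ := by
    intro φ ψ
    have hV : V φ = gammaMat φ ψ * V ψ := by
      fin_cases φ <;> fin_cases ψ <;> simp [gammaMat, hV2, hV3] <;> grind
    rw [hM, hS, hV, mul_assoc]
  refine ⟨hentry, ?_⟩
  ext φ ψ
  rw [Matrix.mul_diagonal, hentry]
end
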